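/- arXiv:2003.00229 — 7 statements merged into one kernel-verified Lean document; each statement's English description precedes it below -/
import Mathlib

section
/- Let σ > 0, Δ > 0, q ∈ [0,1], and let λ be a positive integer. Let ν0(z) = (1/(σ√(2π))) · exp(−z²/(2σ²)) be the density of the Gaussian N(0,σ²), and define f(z) = 1 − q + q·exp((2zΔ − Δ²)/(2σ²)), which is the likelihood ratio ν1(z)/ν0(z) of the mixture ν1 = q·N(Δ,σ²) + (1−q)·N(0,σ²) against ν0. Then ∫_ℝ ν0(z)·f(z)^{λ+1} dz ≥ ∫_ℝ ν0(z)·f(z)^{−λ} dz; i.e., the moment D_{ν1,ν0} = E_{z∼ν0}[(ν1/ν0)^{λ+1}] dominates D_{ν0,ν1} = E_{z∼ν0}[(ν1/ν0)^{−λ}]. -/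
open Real MeasureTheory

lemma add_inv_sub_add_inv_eq {a b : ℝ} (ha : 0 < a) (hb : 0 < b) :
    (a + a⁻¹) - (b + b⁻¹) = (a - b) * ((a * b - 1) / (a * b)) := by
  field_simp
  ring

/-- The two values of the likelihood ratio at points exchanged by the symmetry `t ↦ t⁻¹`
compensate each other. -/
lemma mixture_pow_sub_inv_pow_nonneg {q t : ℝ} (hq0 : 0 ≤ q) (hq1 : q ≤ 1) (ht : 0 < t) (n : ℕ) :
    0 ≤ ((1 - q + q * t) ^ (n + 1) - ((1 - q + q * t) ^ n)⁻¹)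
      + t * ((1 - q + q * t⁻¹) ^ (n + 1) - ((1 - q + q * t⁻¹) ^ n)⁻¹) := by
  have pos (s : ℝ) (hs : 0 < s) : 0 < 1 - q + q * s := by
    rcases hq0.eq_or_lt with rfl | h
    · simp
    · have := mul_pos h hs
      linarith
  have htt : t * t⁻¹ = 1 := mul_inv_cancel₀ ht.ne'
  have hx := pos t ht
  have hy := pos t⁻¹ (inv_pos.2 ht)
  have hx1 : (1 - q + q * t) - 1 = q * (t - 1) := by ring
  have hy1 : t * ((1 - q + q * t⁻¹) - 1) = - (q * (t - 1)) := by linear_combination q * htt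
  have hxy : (1 - q + q * t) - (1 - q + q * t⁻¹) = q * (t - t⁻¹) := by ring
  have hprod : 1 ≤ (1 - q + q * t) * (1 - q + q * t⁻¹) := by
    have h1 : (1 - q + q * t) * (1 - q + q * t⁻¹) = 1 + q * (1 - q) * ((t - 1) ^ 2 * t⁻¹) := by
      field_simp
      ring
    have : 0 ≤ q * (1 - q) * ((t - 1) ^ 2 * t⁻¹) :=
      mul_nonneg (mul_nonneg hq0 (by linarith)) (by positivity)
    linarith
  generalize 1 - q + q * t = x at *
  generalize 1 - q + q * t⁻¹ = y at *
  induction n with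
  | zero => simp only [zero_add, pow_one, pow_zero, inv_one]; linarith
  | succ n ih =>
    have step (z : ℝ) (hz : 0 < z) : z ^ (n + 1 + 1) - (z ^ (n + 1))⁻¹ =
        (z ^ (n + 1) - (z ^ n)⁻¹) + (z - 1) * (z ^ (n + 1) + (z ^ (n + 1))⁻¹) := by
      field_simp
      ring
    have key : 0 ≤ q * (t - 1) * ((x ^ (n + 1) + (x ^ (n + 1))⁻¹)
        - (y ^ (n + 1) + (y ^ (n + 1))⁻¹)) := by
      rw [add_inv_sub_add_inv_eq (pow_pos hx _) (pow_pos hy _), ← mul_assoc]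
      refine mul_nonneg ?_ (div_nonneg ?_ (by positivity))
      · rcases le_total 1 t with h | h
        · have : t⁻¹ ≤ 1 := inv_le_one_of_one_le₀ h
          have hle : y ≤ x := by nlinarith
          exact mul_nonneg (mul_nonneg hq0 (by linarith))
            (sub_nonneg.2 (pow_le_pow_left₀ hy.le hle _))
        · have : 1 ≤ t⁻¹ := (one_le_inv₀ ht).2 h
          have hle : x ≤ y := by nlinarith
          exact mul_nonneg_of_nonpos_of_nonpos
            (mul_nonpos_of_nonneg_of_nonpos hq0 (by linarith))
            (sub_nonpos.2 (pow_le_pow_left₀ hx.le hle _))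
      · rw [← mul_pow]
        exact sub_nonneg.2 (one_le_pow₀ hprod)
    rw [step x hx, step y hy]
    linear_combination ih + key - (x ^ (n + 1) + (x ^ (n + 1))⁻¹) * hx1
      - (y ^ (n + 1) + (y ^ (n + 1))⁻¹) * hy1

lemma integrable_exp_neg_mul_sq_add {b : ℝ} (hb : 0 < b) (c d : ℝ) :
    Integrable fun z : ℝ => Real.exp (-b * z ^ 2 + c * z + d) := by
  refine (((integrable_exp_neg_mul_sq hb).comp_sub_right (c / (2 * b))).const_mul
    (Real.exp (d + c ^ 2 / (4 * b)))).congr (.of_forall fun z => ?_)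
  simp only [← Real.exp_add]
  congr 1
  field_simp
  ring

lemma mixture_mem_Icc {q t : ℝ} (hq0 : 0 ≤ q) (hq1 : q ≤ 1) :
    1 - q + q * t ∈ Set.Icc (min 1 t) (max 1 t) := by
  constructor
  · nlinarith [min_le_left 1 t, min_le_right 1 t]
  · nlinarith [le_max_left 1 t, le_max_right 1 t]

/-- The integrand is dominated by the sum of its values for `q = 0` and `q = 1`. -/
lemma integrable_gaussian_mul_mixture_rpow {b q : ℝ} (hb : 0 < b) (hq0 : 0 ≤ q) (hq1 : q ≤ 1)
    (C c d p : ℝ) :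
    Integrable fun z : ℝ =>
      C * Real.exp (-b * z ^ 2) * (1 - q + q * Real.exp (c * z + d)) ^ p := by
  have pos (z : ℝ) : 0 < 1 - q + q * Real.exp (c * z + d) :=
    (lt_min one_pos (Real.exp_pos _)).trans_le (mixture_mem_Icc hq0 hq1).1
  have hcont : Continuous fun z : ℝ =>
      Real.exp (-b * z ^ 2) * (1 - q + q * Real.exp (c * z + d)) ^ p :=
    (by fun_prop : Continuous fun z : ℝ => Real.exp (-b * z ^ 2)).mul
      ((by fun_prop : Continuous fun z : ℝ => 1 - q + q * Real.exp (c * z + d)).rpow_const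
        fun z => .inl (pos z).ne')
  have hint : Integrable fun z : ℝ =>
      Real.exp (-b * z ^ 2) * (1 - q + q * Real.exp (c * z + d)) ^ p := by
    refine ((integrable_exp_neg_mul_sq hb).add
      (integrable_exp_neg_mul_sq_add hb (c * p) (d * p))).mono' hcont.aestronglyMeasurable
      (.of_forall fun z => ?_)
    have hrpow := Real.rpow_pos_of_pos (pos z) p
    rw [Real.norm_of_nonneg (by positivity)]
    have bound : (1 - q + q * Real.exp (c * z + d)) ^ p ≤ 1 + Real.exp (c * z + d) ^ p := by
      have hm := mixture_mem_Icc (t := Real.exp (c * z + d)) hq0 hq1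
      have he := Real.rpow_pos_of_pos (Real.exp_pos (c * z + d)) p
      rcases le_total 0 p with hp | hp
      · refine (Real.rpow_le_rpow (pos z).le hm.2 hp).trans ?_
        rcases max_choice 1 (Real.exp (c * z + d)) with h | h <;> rw [h]
        · rw [Real.one_rpow]; linarith
        · linarith
      · refine (Real.rpow_le_rpow_of_nonpos (lt_min one_pos (Real.exp_pos _)) hm.1 hp).trans ?_
        rcases min_choice 1 (Real.exp (c * z + d)) with h | h <;> rw [h]
        · rw [Real.one_rpow]; linarith
        · linarith
    calc _ ≤ Real.exp (-b * z ^ 2) * (1 + Real.exp (c * z + d) ^ p) := by gcongr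
      _ = _ := by
        rw [mul_add, mul_one, ← Real.exp_mul, ← Real.exp_add, Pi.add_apply]
        ring_nf
  simpa only [mul_assoc] using hint.const_mul C

/-- Lemma 1: the moment `D_{ν1,ν0}` dominates `D_{ν0,ν1}`. -/
theorem stmt_0 (σ Δ q : ℝ) (hσ : 0 < σ) (hΔ : 0 < Δ) (hq : q ∈ Set.Icc (0 : ℝ) 1)
    (lam : ℕ) (hlam : 0 < lam)
    (ν0 : ℝ → ℝ) (hν0 : ∀ z, ν0 z = 1 / (σ * Real.sqrt (2 * Real.pi)) * Real.exp (-z ^ 2 / (2 * σ ^ 2)))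
    (f : ℝ → ℝ) (hf : ∀ z, f z = 1 - q + q * Real.exp ((2 * z * Δ - Δ ^ 2) / (2 * σ ^ 2))) :
    ∫ z : ℝ, ν0 z * f z ^ ((lam : ℝ) + 1) ≥ ∫ z : ℝ, ν0 z * f z ^ (-(lam : ℝ)) := by
  obtain ⟨hq0, hq1⟩ := hq
  have hint (p : ℝ) : Integrable fun z => ν0 z * f z ^ p := by
    refine (integrable_gaussian_mul_mixture_rpow (b := 1 / (2 * σ ^ 2)) (by positivity) hq0 hq1
      (1 / (σ * Real.sqrt (2 * Real.pi))) (Δ / σ ^ 2) (-Δ ^ 2 / (2 * σ ^ 2)) p).congr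
      (.of_forall fun z => ?_)
    have h1 : -(1 / (2 * σ ^ 2)) * z ^ 2 = -z ^ 2 / (2 * σ ^ 2) := by ring
    have h2 : Δ / σ ^ 2 * z + -Δ ^ 2 / (2 * σ ^ 2) = (2 * z * Δ - Δ ^ 2) / (2 * σ ^ 2) := by
      field_simp
      ring
    simp only [hν0, hf, h1, h2]
  set F : ℝ → ℝ := fun z => ν0 z * f z ^ ((lam : ℝ) + 1) - ν0 z * f z ^ (-(lam : ℝ)) with hF
  have hFint : Integrable F := (hint _).sub (hint _)
  have hpoint (z : ℝ) : 0 ≤ F z + F (Δ - z) := by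
    set t := Real.exp ((2 * z * Δ - Δ ^ 2) / (2 * σ ^ 2)) with ht
    have htpos : 0 < t := Real.exp_pos _
    have hfz' : f (Δ - z) = 1 - q + q * t⁻¹ := by
      rw [hf, ht, ← Real.exp_neg]
      ring_nf
    have hνz' : ν0 (Δ - z) = ν0 z * t := by
      rw [hν0, hν0, ht, mul_assoc, ← Real.exp_add]
      ring_nf
    have hν : 0 ≤ ν0 z := by rw [hν0]; positivity
    have hrpow (w : ℝ) : f w ^ ((lam : ℝ) + 1) - f w ^ (-(lam : ℝ))
        = f w ^ (lam + 1) - (f w ^ lam)⁻¹ := by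
      have hw : 0 < f w := by
        rw [hf]
        exact (lt_min one_pos (Real.exp_pos _)).trans_le (mixture_mem_Icc hq0 hq1).1
      rw [Real.rpow_neg hw.le, Real.rpow_natCast, ← Nat.cast_succ, Real.rpow_natCast]
    have key := mul_nonneg hν (mixture_pow_sub_inv_pow_nonneg hq0 hq1 htpos lam)
    simp only [hF]
    rw [← mul_sub, ← mul_sub, hrpow, hrpow, hνz', hfz', hf z, ← ht]
    linear_combination key
  have hsum : 0 ≤ (∫ z, F z) + ∫ z, F (Δ - z) := by
    rw [← integral_add hFint (hFint.comp_sub_left Δ)]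
    exact integral_nonneg hpoint
  rw [integral_sub_left_eq_self F volume Δ] at hsum
  have hsub : ∫ z, F z = _ := integral_sub (hint ((lam : ℝ) + 1)) (hint (-(lam : ℝ)))
  linarith
end

section
/- Let σ > 0, Δ > 0, q ∈ [0,1], and let n be a natural number. Let ν0(z) = (1/(σ√(2π))) · exp(−z²/(2σ²)) and f(z) = 1 − q + q·exp((2zΔ − Δ²)/(2σ²)). Then ∫_ℝ ν0(z)·f(z)^n dz = Σ_{l=0}^{n} C(n,l)·(1−q)^{n−l}·q^l·exp(l(l−1)Δ²/(2σ²)), where C(n,l) is the binomial coefficient. -/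
open Real MeasureTheory

/-- Tilting a centred Gaussian density by the `l`-th power of the likelihood ratio of a shift by
`Δ` gives, up to a constant factor, the Gaussian density with mean `l * Δ`. -/
lemma gaussian_density_mul_likelihoodRatio_pow {σ : ℝ} (hσ : 0 < σ) (Δ z : ℝ) (l : ℕ) :
    1 / (σ * √(2 * π)) * exp (-z ^ 2 / (2 * σ ^ 2)) * exp ((2 * z * Δ - Δ ^ 2) / (2 * σ ^ 2)) ^ l
      = exp ((l : ℝ) * ((l : ℝ) - 1) * Δ ^ 2 / (2 * σ ^ 2))
        * ProbabilityTheory.gaussianPDFReal (l * Δ) (σ ^ 2).toNNReal z := by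
  have hsqrt : √(2 * π * σ ^ 2) = σ * √(2 * π) := by
    rw [Real.sqrt_mul (by positivity), Real.sqrt_sq hσ.le, mul_comm]
  rw [ProbabilityTheory.gaussianPDFReal, Real.coe_toNNReal _ (sq_nonneg σ), hsqrt,
    ← Real.exp_nat_mul, mul_assoc, ← Real.exp_add, one_div, mul_left_comm, ← Real.exp_add]
  congr 2
  field_simp
  ring

/-- Exact binomial-sum evaluation of the `n`-th moment of the mixture likelihood ratio. -/
theorem stmt_2 (σ Δ q : ℝ) (hσ : 0 < σ) (hΔ : 0 < Δ) (hq : q ∈ Set.Icc (0 : ℝ) 1) (n : ℕ)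
    (ν0 : ℝ → ℝ) (hν0 : ∀ z, ν0 z = 1 / (σ * Real.sqrt (2 * Real.pi)) * Real.exp (-z ^ 2 / (2 * σ ^ 2)))
    (f : ℝ → ℝ) (hf : ∀ z, f z = 1 - q + q * Real.exp ((2 * z * Δ - Δ ^ 2) / (2 * σ ^ 2))) :
    ∫ z : ℝ, ν0 z * f z ^ n
      = ∑ l ∈ Finset.range (n + 1),
          (n.choose l : ℝ) * (1 - q) ^ (n - l) * q ^ l
            * Real.exp ((l : ℝ) * ((l : ℝ) - 1) * Δ ^ 2 / (2 * σ ^ 2)) := by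
  have hv : (σ ^ 2).toNNReal ≠ 0 := (Real.toNNReal_pos.2 (by positivity)).ne'
  have hexpand (z : ℝ) : ν0 z * f z ^ n = ∑ l ∈ Finset.range (n + 1),
      (n.choose l : ℝ) * (1 - q) ^ (n - l) * q ^ l
        * Real.exp ((l : ℝ) * ((l : ℝ) - 1) * Δ ^ 2 / (2 * σ ^ 2))
        * ProbabilityTheory.gaussianPDFReal (l * Δ) (σ ^ 2).toNNReal z := by
    rw [hf, add_comm (1 - q), add_pow, Finset.mul_sum]
    refine Finset.sum_congr rfl fun l _ ↦ ?_
    rw [mul_assoc (_ * q ^ l), ← gaussian_density_mul_likelihoodRatio_pow hσ, hν0, mul_pow]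
    ring
  simp_rw [hexpand]
  rw [integral_finsetSum _ fun l _ ↦
    (ProbabilityTheory.integrable_gaussianPDFReal _ _).const_mul _]
  refine Finset.sum_congr rfl fun l _ ↦ ?_
  rw [integral_const_mul, ProbabilityTheory.integral_gaussianPDFReal_eq_one _ hv, mul_one]
end

section
/- Let σ > 0, Δ > 0, q ∈ [0,1], and let λ be a positive integer. Let ν0(z) = (1/(σ√(2π))) · exp(−z²/(2σ²)) and f(z) = 1 − q + q·exp((2zΔ − Δ²)/(2σ²)). Then ∫_ℝ ν0(z)·f(z)^{λ+1} dz ≤ exp( q(λ+1)·( exp(λΔ²/(2σ²)) − 1 ) ). -/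
open Real MeasureTheory

/-- Tilting a centred Gaussian density by the `k`-th power of the likelihood ratio of the shift
by `Δ` yields a multiple of the Gaussian density with mean `k * Δ`. -/
lemma gaussian_mul_likelihoodRatio_pow {σ : ℝ} (hσ : 0 < σ) (Δ z : ℝ) (k : ℕ) :
    1 / (σ * √(2 * π)) * exp (-z ^ 2 / (2 * σ ^ 2)) *
        exp ((2 * z * Δ - Δ ^ 2) / (2 * σ ^ 2)) ^ k =
      exp ((k : ℝ) * (k - 1) * (Δ ^ 2 / (2 * σ ^ 2))) *
        ProbabilityTheory.gaussianPDFReal (k * Δ) (σ ^ 2).toNNReal z := by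
  have hc : √(2 * π * σ ^ 2) = σ * √(2 * π) := by
    rw [mul_comm, Real.sqrt_mul (sq_nonneg σ), Real.sqrt_sq hσ.le]
  rw [ProbabilityTheory.gaussianPDFReal, Real.coe_toNNReal _ (sq_nonneg σ), hc, one_div,
    mul_left_comm, mul_assoc, ← exp_nat_mul, ← exp_add, ← exp_add]
  congr 2
  field_simp
  ring

/-- Full moment bound `D_{ν1,ν0} ≤ exp(q(λ+1)(e^{λΔ²/(2σ²)} − 1))` from the proof of Theorem 1. -/
theorem stmt_4 (σ Δ q : ℝ) (hσ : 0 < σ) (hΔ : 0 < Δ) (hq : q ∈ Set.Icc (0 : ℝ) 1)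
    (lam : ℕ) (hlam : 0 < lam)
    (ν0 : ℝ → ℝ) (hν0 : ∀ z, ν0 z = 1 / (σ * Real.sqrt (2 * Real.pi)) * Real.exp (-z ^ 2 / (2 * σ ^ 2)))
    (f : ℝ → ℝ) (hf : ∀ z, f z = 1 - q + q * Real.exp ((2 * z * Δ - Δ ^ 2) / (2 * σ ^ 2))) :
    ∫ z : ℝ, ν0 z * f z ^ (lam + 1)
      ≤ Real.exp (q * ((lam : ℝ) + 1) * (Real.exp ((lam : ℝ) * Δ ^ 2 / (2 * σ ^ 2)) - 1)) := by
  obtain ⟨hq0, hq1⟩ := hq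
  have hv : (σ ^ 2).toNNReal ≠ 0 := (Real.toNNReal_pos.2 (by positivity)).ne'
  have ha : 0 ≤ Δ ^ 2 / (2 * σ ^ 2) := by positivity
  have hq' : 0 ≤ 1 - q := sub_nonneg.2 hq1
  have expand : ∀ z, ν0 z * f z ^ (lam + 1) = ∑ k ∈ Finset.range (lam + 1 + 1),
      (q ^ k * (1 - q) ^ (lam + 1 - k) * ((lam + 1).choose k : ℝ) *
        exp ((k : ℝ) * (k - 1) * (Δ ^ 2 / (2 * σ ^ 2)))) *
        ProbabilityTheory.gaussianPDFReal (k * Δ) (σ ^ 2).toNNReal z := by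
    intro z
    rw [hf, add_comm (1 - q), add_pow, Finset.mul_sum]
    refine Finset.sum_congr rfl fun k _ => ?_
    rw [mul_assoc _ (exp _), ← gaussian_mul_likelihoodRatio_pow hσ, ← hν0, mul_pow]
    ring
  simp_rw [expand]
  rw [integral_finsetSum _ fun k _ =>
    (ProbabilityTheory.integrable_gaussianPDFReal _ _).const_mul _]
  simp_rw [integral_const_mul, ProbabilityTheory.integral_gaussianPDFReal_eq_one _ hv, mul_one]
  set E := exp ((lam : ℝ) * Δ ^ 2 / (2 * σ ^ 2)) with hE
  calc _ ≤ ∑ k ∈ Finset.range (lam + 1 + 1),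
        (q * E) ^ k * (1 - q) ^ (lam + 1 - k) * ((lam + 1).choose k : ℝ) := by
        refine Finset.sum_le_sum fun k hk => ?_
        have hk' : (k : ℝ) - 1 ≤ lam := by
          have : k ≤ lam + 1 := Nat.lt_succ_iff.1 (Finset.mem_range.1 hk)
          rw [sub_le_iff_le_add]
          exact_mod_cast this
        have hexp : exp ((k : ℝ) * (k - 1) * (Δ ^ 2 / (2 * σ ^ 2))) ≤ E ^ k := by
          rw [hE, ← exp_nat_mul, mul_div_assoc, ← mul_assoc]
          gcongr
        calc _ ≤ q ^ k * (1 - q) ^ (lam + 1 - k) * ((lam + 1).choose k : ℝ) * E ^ k := by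
              gcongr
          _ = _ := by rw [mul_pow]; ring
    _ = (q * (E - 1) + 1) ^ (lam + 1) := by
        rw [← add_pow]
        ring
    _ ≤ exp (q * (E - 1)) ^ (lam + 1) := by
        have hE1 : 1 ≤ E := one_le_exp (by positivity)
        have : 0 ≤ q * (E - 1) := mul_nonneg hq0 (sub_nonneg.2 hE1)
        gcongr
        exact add_one_le_exp _
    _ = _ := by
        rw [← exp_nat_mul]
        push_cast
        ring_nf
end

section
/- Let σ > 0, Δ > 0, q ∈ [0,1], and let λ be a positive integer. Define g(y) = 1 − q + q·exp(yΔ/σ²). Then for every z ≥ 0, exp(−(z+Δ/2)²/(2σ²))·g(z)^{λ+1} + exp(−(z−Δ/2)²/(2σ²))·g(−z)^{λ+1} ≥ exp(−(z+Δ/2)²/(2σ²))·g(z)^{−λ} + exp(−(z−Δ/2)²/(2σ²))·g(−z)^{−λ}. -/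
open Real

/-- The symmetric geometric sum `∑_{|k| ≤ n} y ^ k`. -/
noncomputable def symmGeomSum (n : ℕ) (y : ℝ) : ℝ :=
  1 + ∑ j ∈ Finset.range n, (y ^ (j + 1) + (y ^ (j + 1))⁻¹)

lemma sub_one_mul_symmGeomSum (n : ℕ) {y : ℝ} (hy : y ≠ 0) :
    (y - 1) * symmGeomSum n y = y ^ (n + 1) - (y ^ n)⁻¹ := by
  induction n with
  | zero => simp [symmGeomSum]
  | succ n ih =>
    have h : symmGeomSum (n + 1) y = symmGeomSum n y + (y ^ (n + 1) + (y ^ (n + 1))⁻¹) := by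
      simp only [symmGeomSum, Finset.sum_range_succ]
      ring
    rw [h, mul_add, ih]
    field_simp
    ring

lemma add_inv_le_add_inv_of_one_le_mul {a b : ℝ} (hb : 0 < b) (hba : b ≤ a) (hab : 1 ≤ a * b) :
    b + b⁻¹ ≤ a + a⁻¹ := by
  have ha : 0 < a := hb.trans_le hba
  have h : a + a⁻¹ - (b + b⁻¹) = (a - b) * (a * b - 1) / (a * b) := by
    field_simp
    ring
  have : 0 ≤ (a - b) * (a * b - 1) / (a * b) :=
    div_nonneg (mul_nonneg (sub_nonneg.2 hba) (sub_nonneg.2 hab)) (mul_pos ha hb).le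
  linarith

lemma symmGeomSum_le_symmGeomSum (n : ℕ) {a b : ℝ} (hb : 0 < b) (hba : b ≤ a)
    (hab : 1 ≤ a * b) : symmGeomSum n b ≤ symmGeomSum n a := by
  unfold symmGeomSum
  gcongr 1 + ?_
  refine Finset.sum_le_sum fun j _ => add_inv_le_add_inv_of_one_le_mul (pow_pos hb _)
    (pow_le_pow_left₀ hb.le hba _) ?_
  rw [← mul_pow]
  exact one_le_pow₀ hab

/-- The two-point inequality with likelihood ratio `t` and mixture weight `q`. -/
lemma mixture_inv_pow_le_pow (n : ℕ) {q t : ℝ} (hq0 : 0 ≤ q) (hq1 : q ≤ 1) (ht : 1 ≤ t) :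
    ((1 - q + q * t) ^ n)⁻¹ + t * ((1 - q + q * t⁻¹) ^ n)⁻¹ ≤
      (1 - q + q * t) ^ (n + 1) + t * (1 - q + q * t⁻¹) ^ (n + 1) := by
  have ht0 : 0 < t := one_pos.trans_le ht
  have hti : t⁻¹ ≤ 1 := inv_le_one_of_one_le₀ ht
  have hti0 : 0 < t⁻¹ := inv_pos.2 ht0
  have htt : t * t⁻¹ = 1 := mul_inv_cancel₀ ht0.ne'
  set a := 1 - q + q * t with ha_def
  set b := 1 - q + q * t⁻¹ with hb_def
  have hb : 0 < b := by nlinarith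
  have hba : b ≤ a := by nlinarith
  have hab : 1 ≤ a * b := by
    have h : a * b - 1 = q * (1 - q) * ((t - 1) * (1 - t⁻¹)) := by
      rw [ha_def, hb_def]
      linear_combination (q ^ 2 + q * (1 - q)) * htt
    have : 0 ≤ q * (1 - q) * ((t - 1) * (1 - t⁻¹)) :=
      mul_nonneg (mul_nonneg hq0 (sub_nonneg.2 hq1))
        (mul_nonneg (sub_nonneg.2 ht) (sub_nonneg.2 hti))
    linarith
  have hsum := symmGeomSum_le_symmGeomSum n hb hba hab
  have ea := sub_one_mul_symmGeomSum n (hb.trans_le hba).ne'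
  have eb := sub_one_mul_symmGeomSum n hb.ne'
  have hbal : t * (b - 1) = -(a - 1) := by
    rw [ha_def, hb_def]
    linear_combination q * htt
  have ha1 : 0 ≤ a - 1 := by nlinarith
  have key : a ^ (n + 1) - (a ^ n)⁻¹ + t * (b ^ (n + 1) - (b ^ n)⁻¹) =
      (a - 1) * (symmGeomSum n a - symmGeomSum n b) := by
    rw [← ea, ← eb]
    linear_combination symmGeomSum n b * hbal
  have := mul_nonneg ha1 (sub_nonneg.2 hsum)
  linarith

/-- Pointwise inequality `φ_pos(z) ≥ φ_neg(z)` on `[0, ∞)` from the proof of Lemma 1. -/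
theorem stmt_6 (σ Δ q : ℝ) (hσ : 0 < σ) (hΔ : 0 < Δ) (hq : q ∈ Set.Icc (0 : ℝ) 1)
    (lam : ℕ) (hlam : 0 < lam)
    (g : ℝ → ℝ) (hg : ∀ y, g y = 1 - q + q * Real.exp (y * Δ / σ ^ 2)) :
    ∀ z : ℝ, 0 ≤ z →
      Real.exp (-(z + Δ / 2) ^ 2 / (2 * σ ^ 2)) * g z ^ ((lam : ℝ) + 1)
          + Real.exp (-(z - Δ / 2) ^ 2 / (2 * σ ^ 2)) * g (-z) ^ ((lam : ℝ) + 1)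
        ≥ Real.exp (-(z + Δ / 2) ^ 2 / (2 * σ ^ 2)) * g z ^ (-(lam : ℝ))
          + Real.exp (-(z - Δ / 2) ^ 2 / (2 * σ ^ 2)) * g (-z) ^ (-(lam : ℝ)) := by
  intro z hz
  have hpos : ∀ y, 0 < g y := fun y => by
    rw [hg]
    rcases hq.2.lt_or_eq with h | h
    · exact add_pos_of_pos_of_nonneg (sub_pos.2 h) (mul_nonneg hq.1 (exp_pos _).le)
    · rw [h]
      simpa using exp_pos _
  have hsucc : ∀ y, g y ^ ((lam : ℝ) + 1) = g y ^ (lam + 1) := fun y => by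
    rw [← rpow_natCast, Nat.cast_succ]
  have hneg : ∀ y, g y ^ (-(lam : ℝ)) = (g y ^ lam)⁻¹ := fun y => by
    rw [rpow_neg (hpos y).le, rpow_natCast]
  have hw : exp (-(z - Δ / 2) ^ 2 / (2 * σ ^ 2)) =
      exp (-(z + Δ / 2) ^ 2 / (2 * σ ^ 2)) * exp (z * Δ / σ ^ 2) := by
    rw [← exp_add]
    congr 1
    field_simp
    ring
  have hinv : exp (-z * Δ / σ ^ 2) = (exp (z * Δ / σ ^ 2))⁻¹ := by
    rw [← exp_neg]
    congr 1
    ring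
  have key := mixture_inv_pow_le_pow lam hq.1 hq.2
    (one_le_exp (by positivity : 0 ≤ z * Δ / σ ^ 2))
  rw [← hinv, ← hg, ← hg] at key
  simp only [hsucc, hneg, hw, mul_assoc, ← mul_add]
  exact mul_le_mul_of_nonneg_left key (exp_pos _).le
end

section
/- Let λ be a positive integer and let γ be a real number with 0 ≤ γ ≤ λ + 1. Then (1 + 2λγ/(λ+1)) · (1 − γ/(λ+1))^{2λ} ≤ 1. -/
theorem one_add_mul_mul_one_sub_pow_le_one {t : ℝ} (ht0 : 0 ≤ t) (ht1 : t ≤ 1) (n : ℕ) :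
    (1 + n * t) * (1 - t) ^ n ≤ 1 :=
  calc (1 + n * t) * (1 - t) ^ n ≤ (1 + t) ^ n * (1 - t) ^ n :=
        mul_le_mul_of_nonneg_right (one_add_mul_le_pow (by linarith) n)
          (pow_nonneg (by linarith) n)
    _ = (1 - t ^ 2) ^ n := by rw [← mul_pow]; ring
    _ ≤ 1 := pow_le_one₀ (by nlinarith) (by nlinarith)

/-- Nonnegativity of `ψ'` in the proof of Lemma 1. -/
theorem stmt_7 (lam : ℕ) (hlam : 0 < lam) (γ : ℝ) (hγ0 : 0 ≤ γ) (hγ1 : γ ≤ (lam : ℝ) + 1) :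
    (1 + 2 * (lam : ℝ) * γ / ((lam : ℝ) + 1)) * (1 - γ / ((lam : ℝ) + 1)) ^ (2 * lam) ≤ 1 := by
  have hpos : (0 : ℝ) < lam + 1 := by positivity
  have h := one_add_mul_mul_one_sub_pow_le_one (div_nonneg hγ0 hpos.le)
    ((div_le_one hpos).2 hγ1) (2 * lam)
  push_cast at h
  rwa [mul_div_assoc]
end

section
/- Let λ be a positive integer and define ψ(γ) = γ + 1 + (λγ/(λ+1) + 1) · (1 − γ/(λ+1))^{2λ+1} for real γ. Then ψ is nondecreasing on the interval [0, λ+1]; in particular ψ(γ) ≥ ψ(0) = 2 for all γ ∈ [0, λ+1]. -/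
theorem pow_mul_add_one_sub_le_one {s : ℝ} (hs : 0 ≤ s) (m : ℕ) :
    s ^ m * (m + 1 - m * s) ≤ 1 := by
  induction m with
  | zero => simp
  | succ m ih =>
    have h : 0 ≤ ((m : ℝ) + 1) * s ^ m * (1 - s) ^ 2 := by positivity
    push_cast
    linear_combination ih + h

/-- The auxiliary function `ψ` of the proof of Lemma 1 is nondecreasing on `[0, λ+1]`,
and in particular `ψ(γ) ≥ ψ(0) = 2` there. -/
theorem stmt_8 (lam : ℕ) (hlam : 0 < lam)
    (ψ : ℝ → ℝ)
    (hψ : ∀ γ : ℝ, ψ γ = γ + 1 + ((lam : ℝ) * γ / ((lam : ℝ) + 1) + 1)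
        * (1 - γ / ((lam : ℝ) + 1)) ^ (2 * lam + 1)) :
    MonotoneOn ψ (Set.Icc (0 : ℝ) ((lam : ℝ) + 1)) ∧ ψ 0 = 2 ∧
      ∀ γ ∈ Set.Icc (0 : ℝ) ((lam : ℝ) + 1), 2 ≤ ψ γ := by
  have ha : (0 : ℝ) < (lam : ℝ) + 1 := by positivity
  have hderiv (x : ℝ) : HasDerivAt ψ
      (1 - (1 - x / ((lam : ℝ) + 1)) ^ (2 * lam) *
        (((2 * lam : ℕ) : ℝ) + 1 - ((2 * lam : ℕ) : ℝ) * (1 - x / ((lam : ℝ) + 1)))) x := by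
    rw [funext hψ]
    have h1 := (((hasDerivAt_id x).const_mul (lam : ℝ)).div_const ((lam : ℝ) + 1)).add_const 1
    have h2 := (((hasDerivAt_id x).div_const ((lam : ℝ) + 1)).const_sub 1).pow (2 * lam + 1)
    refine (((hasDerivAt_id x).add_const 1).add (h1.mul h2)).congr_deriv ?_
    simp only [id, Nat.add_sub_cancel, pow_succ, Pi.pow_apply]
    push_cast
    field_simp
    ring
  have hmono : MonotoneOn ψ (Set.Icc (0 : ℝ) ((lam : ℝ) + 1)) := by
    refine monotoneOn_of_deriv_nonneg (convex_Icc _ _)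
      (fun x _ => (hderiv x).continuousAt.continuousWithinAt)
      (fun x _ => (hderiv x).differentiableAt.differentiableWithinAt) fun x hx => ?_
    rw [interior_Icc] at hx
    rw [(hderiv x).deriv, sub_nonneg]
    exact pow_mul_add_one_sub_le_one (sub_nonneg.2 ((div_le_one ha).2 hx.2.le)) _
  have h0 : ψ 0 = 2 := by
    rw [hψ]
    norm_num
  exact ⟨hmono, h0, fun γ hγ => h0 ▸ hmono (Set.left_mem_Icc.2 ha.le) hγ hγ.1⟩
end

section
/- Let 0 < A < 1 and a, b, c > 0, and define h : ℝ → ℝ by h(T) = A^T·a + (1 − A^T)·(bT + c). Then h is twice differentiable with h''(T) = A^T·(ln A)²·(a − bT − c) − 2b·A^T·ln A for every T; in particular, h''(T) > 0 for every T with bT + c ≤ a (since ln A < 0), so h is strictly convex on the region where bT + c ≤ a. -/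
open Real

theorem hasDerivAt_rpow_mul_add_one_sub_rpow_mul {A : ℝ} (hA : 0 < A) (a b c T : ℝ) :
    HasDerivAt (fun T : ℝ => A ^ T * a + (1 - A ^ T) * (b * T + c))
      (A ^ T * Real.log A * (a - b * T - c) + (1 - A ^ T) * b) T := by
  have hpow := (hasStrictDerivAt_const_rpow hA T).hasDerivAt
  have hlin := ((hasDerivAt_id T).const_mul b).add_const c
  refine ((hpow.mul_const a).add ((hpow.const_sub 1).mul hlin)).congr_deriv ?_
  simp only [id]
  ring

theorem hasDerivAt_rpow_mul_log_mul_sub_add_one_sub_rpow_mul {A : ℝ} (hA : 0 < A)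
    (a b c T : ℝ) :
    HasDerivAt (fun T : ℝ => A ^ T * Real.log A * (a - b * T - c) + (1 - A ^ T) * b)
      (A ^ T * Real.log A ^ 2 * (a - b * T - c) - 2 * b * A ^ T * Real.log A) T := by
  have hpow := (hasStrictDerivAt_const_rpow hA T).hasDerivAt
  have hlin := (((hasDerivAt_id T).const_mul b).const_sub a).sub_const c
  refine (((hpow.mul_const (Real.log A)).mul hlin).add
    ((hpow.const_sub 1).mul_const b)).congr_deriv ?_
  simp only [id]
  ring

/-- Second-derivative computation for the convergence bound `h(T) = A^T·a + (1−A^T)(bT+c)`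
(Theorem 3): `h'' (T) = A^T (ln A)² (a − bT − c) − 2b A^T ln A`, which is positive whenever
`bT + c ≤ a`, so `h` is strictly convex on that region. -/
theorem stmt_16 (A a b c : ℝ) (hA0 : 0 < A) (hA1 : A < 1)
    (ha : 0 < a) (hb : 0 < b) (hc : 0 < c)
    (h : ℝ → ℝ) (hh : ∀ T : ℝ, h T = A ^ T * a + (1 - A ^ T) * (b * T + c)) :
    ContDiff ℝ 2 h ∧
      (∀ T : ℝ, iteratedDeriv 2 h T
        = A ^ T * Real.log A ^ 2 * (a - b * T - c) - 2 * b * A ^ T * Real.log A) ∧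
      (∀ T : ℝ, b * T + c ≤ a → 0 < iteratedDeriv 2 h T) ∧
      StrictConvexOn ℝ {T : ℝ | b * T + c ≤ a} h := by
  obtain rfl : h = fun T : ℝ => A ^ T * a + (1 - A ^ T) * (b * T + c) := funext hh
  have hpow : ContDiff ℝ 2 fun T : ℝ => A ^ T :=
    contDiff_const.rpow contDiff_id fun _ => hA0.ne'
  have hsmooth : ContDiff ℝ 2 fun T : ℝ => A ^ T * a + (1 - A ^ T) * (b * T + c) := by
    fun_prop
  have hderiv2 (T : ℝ) :
      iteratedDeriv 2 (fun T : ℝ => A ^ T * a + (1 - A ^ T) * (b * T + c)) T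
        = A ^ T * Real.log A ^ 2 * (a - b * T - c) - 2 * b * A ^ T * Real.log A := by
    rw [iteratedDeriv_succ, iteratedDeriv_one,
      funext fun T => (hasDerivAt_rpow_mul_add_one_sub_rpow_mul hA0 a b c T).deriv]
    exact (hasDerivAt_rpow_mul_log_mul_sub_add_one_sub_rpow_mul hA0 a b c T).deriv
  have hpos (T : ℝ) (hT : b * T + c ≤ a) :
      0 < iteratedDeriv 2 (fun T : ℝ => A ^ T * a + (1 - A ^ T) * (b * T + c)) T := by
    rw [hderiv2]
    have hA : 0 < A ^ T := rpow_pos_of_pos hA0 T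
    have hnonneg : 0 ≤ A ^ T * Real.log A ^ 2 * (a - b * T - c) :=
      mul_nonneg (by positivity) (by linarith)
    have hneg : 2 * b * A ^ T * Real.log A < 0 :=
      mul_neg_of_pos_of_neg (by positivity) (Real.log_neg hA0 hA1)
    linarith
  have hconvex : Convex ℝ {T : ℝ | b * T + c ≤ a} := by
    intro x hx y hy s t hs ht hst
    simp only [Set.mem_ofPred_eq, smul_eq_mul] at hx hy ⊢
    obtain rfl : t = 1 - s := by linarith
    nlinarith [mul_le_mul_of_nonneg_left hx hs, mul_le_mul_of_nonneg_left hy ht]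
  refine ⟨hsmooth, hderiv2, hpos,
    strictConvexOn_of_deriv2_pos' hconvex hsmooth.continuous.continuousOn fun T hT => ?_⟩
  rw [← iteratedDeriv_eq_iterate]
  exact hpos T hT
end
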